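/- Let ε ∈ {0,1}, let μ, ν ∈ ℤ with μ ≡ ν ≡ ε (mod 2), and let ζ ∈ ℂ with |Re ζ| < 1/2 and (ζ,ε) ≠ (0,1). Then for every x ∈ SL(2,ℝ), φ^{μ,ν}_ζ(x) = (d(ζ,μ)/d(ζ,ν))·φ^{μ,ν}_{−ζ}(x), where d(ζ,k) = 2^{2ζ}·Γ(1/2+ζ+k/2)/Γ(1/2−ζ+k/2). In particular φ^{μ,μ}_ζ = φ^{μ,μ}_{−ζ}. -/

import Mathlib

open MeasureTheory

/-- The right action of `SL(2,ℝ)` on row vectors `v ∈ ℝ²`: `v · x`. -/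
def rowAct (x : Matrix.SpecialLinearGroup (Fin 2) ℝ) (v : ℝ × ℝ) : ℝ × ℝ :=
  (v.1 * x.1 0 0 + v.2 * x.1 1 0, v.1 * x.1 0 1 + v.2 * x.1 1 1)

/-- `F_{ζ,μ}(v₁,v₂) = π^{-1/2}(v₁²+v₂²)^{ζ-(1+μ)/2}(v₁+iv₂)^μ`; on the unit circle it equals
`π^{-1/2} e^{iμθ}`. -/
noncomputable def Fz (ζ : ℂ) (μ : ℤ) (v : ℝ × ℝ) : ℂ :=
  (Real.pi : ℂ) ^ (-(1/2) : ℂ) *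
    ((v.1 ^ 2 + v.2 ^ 2 : ℝ) : ℂ) ^ (ζ - (1 + (μ : ℂ))/2) *
    ((v.1 : ℂ) + (v.2 : ℂ) * Complex.I) ^ μ

/-- The generalised spherical function
`φ^{μ,ν}_ζ(x) = π^{-1/2}∫_{-π/2}^{π/2} F_{ζ,μ}((cos θ, sin θ)·x) e^{-iνθ} dθ`. -/
noncomputable def phi (ζ : ℂ) (μ ν : ℤ) (x : Matrix.SpecialLinearGroup (Fin 2) ℝ) : ℂ :=
  (Real.pi : ℂ) ^ (-(1/2) : ℂ) *
    ∫ θ in (-(Real.pi/2))..(Real.pi/2),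
      Fz ζ μ (rowAct x (Real.cos θ, Real.sin θ)) *
        Complex.exp (-((ν : ℂ) * (θ : ℂ)) * Complex.I)

open ComplexConjugate

/-- An infinite tridiagonal linear system whose coefficients grow at most linearly has no
bounded nonzero solution with zero initial value on a short interval. -/
theorem tridiagonal_eq_zero {u a b c : ℤ → ℝ → ℂ} {M : ℝ}
    (hu : ∀ k t, HasDerivAt (u k)
      (a k t * u k t + b k t * u (k - 1) t + c k t * u (k + 1) t) t)
    (ha : ∀ k t, ‖a k t‖ ≤ (k.natAbs + 1) / 6) (hb : ∀ k t, ‖b k t‖ ≤ (k.natAbs + 1) / 6)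
    (hc : ∀ k t, ‖c k t‖ ≤ (k.natAbs + 1) / 6)
    (hM : ∀ k, ∀ t ∈ Set.Icc (0 : ℝ) 1, ‖u k t‖ ≤ M) (h0 : ∀ k, u k 0 = 0) (k : ℤ) :
    u k 1 = 0 := by
  have hM0 : 0 ≤ M := (norm_nonneg _).trans (hM 0 0 (by simp))
  have key : ∀ n : ℕ, ∀ k : ℤ, ∀ t ∈ Set.Icc (0 : ℝ) 1,
      ‖u k t‖ ≤ M * ((k.natAbs + n).choose n * (t / 2) ^ n) := by
    intro n
    induction n with
    | zero => intro k t ht; simpa using hM k t ht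
    | succ n ih =>
      intro k
      refine image_norm_le_of_norm_deriv_right_le_deriv_boundary
        (B' := fun t => M * ((k.natAbs + (n + 1)).choose (n + 1) *
          ((n + 1 : ℕ) * (t / 2) ^ n * (1 / 2))))
        (fun t _ => (hu k t).continuousAt.continuousWithinAt)
        (fun t _ => (hu k t).hasDerivWithinAt) (by simp [h0]) ?_ ?_
      · intro t
        have h := (((hasDerivAt_id t).div_const 2).pow (n + 1)).const_mul
          ((k.natAbs + (n + 1)).choose (n + 1) : ℝ)
        simpa using h.const_mul M
      · intro t ht
        have ht' : t ∈ Set.Icc (0 : ℝ) 1 := ⟨ht.1, ht.2.le⟩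
        have ht2 : 0 ≤ (t / 2) ^ n := by have := ht.1; positivity
        set m := k.natAbs
        set Q : ℝ := M * ((m + 1 + n).choose n * (t / 2) ^ n)
        have hQ : ∀ j : ℤ, j.natAbs ≤ m + 1 → ‖u j t‖ ≤ Q := fun j hj => by
          refine (ih j t ht').trans ?_
          have : ((j.natAbs + n).choose n : ℝ) ≤ (m + 1 + n).choose n :=
            Nat.cast_le.2 (Nat.choose_le_choose n (by omega))
          exact mul_le_mul_of_nonneg_left (mul_le_mul_of_nonneg_right this ht2) hM0
        have h1 := mul_le_mul (ha k t) (hQ k (by omega)) (norm_nonneg _) (by positivity)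
        have h2 := mul_le_mul (hb k t) (hQ (k - 1) (by omega)) (norm_nonneg _) (by positivity)
        have h3 := mul_le_mul (hc k t) (hQ (k + 1) (by omega)) (norm_nonneg _) (by positivity)
        have h4 := norm_add₃_le (a := a k t * u k t) (b := b k t * u (k - 1) t)
          (c := c k t * u (k + 1) t)
        simp only [norm_mul] at h4
        have h5 : ((m + (n + 1)).choose (n + 1) : ℝ) * (n + 1) =
            (m + 1 + n).choose n * (m + 1) := by
          have := Nat.choose_succ_right_eq (m + 1 + n) n
          rw [show m + 1 + n - n = m + 1 by omega] at this
          rw [show m + (n + 1) = m + 1 + n by omega]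
          exact_mod_cast this
        have h6 : M * (((m + (n + 1)).choose (n + 1) : ℝ) *
            ((n + 1 : ℕ) * (t / 2) ^ n * (1 / 2))) = (m + 1) / 6 * Q * 3 := by
          simp only [Q]
          push_cast
          linear_combination (M * (t / 2) ^ n / 2) * h5
        rw [h6]
        linarith
  have hlim : Filter.Tendsto
      (fun n : ℕ => M * (((k.natAbs + n).choose n : ℝ) * (1 / 2) ^ n)) Filter.atTop (nhds 0) := by
    have h := (summable_choose_mul_geometric_of_norm_lt_one k.natAbs
      (r := (1 / 2 : ℝ)) (by norm_num)).tendsto_atTop_zero.const_mul M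
    rw [mul_zero] at h
    refine h.congr fun n => ?_
    rw [add_comm n, Nat.choose_symm_add]
  have := ge_of_tendsto' hlim fun n => key n k 1 (by simp)
  simpa using this

/-- `F_{ζ,μ}` in the complex coordinate `z = v₁ + iv₂`, without the factor `π^{-1/2}`. -/
noncomputable def Fc (ζ : ℂ) (μ : ℤ) (z : ℂ) : ℂ :=
  (Complex.normSq z : ℂ) ^ (ζ - (1 + (μ : ℂ)) / 2) * z ^ μ

theorem Fc_add_two (ζ : ℂ) (μ : ℤ) {z : ℂ} (hz : z ≠ 0) :
    Fc ζ (μ + 2) z = Fc ζ μ z * (z / conj z) := by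
  have hn : (Complex.normSq z : ℂ) ≠ 0 := by simpa using hz
  have hc : conj z ≠ 0 := by simpa using hz
  have h : ζ - (1 + ((μ + 2 : ℤ) : ℂ)) / 2 = ζ - (1 + (μ : ℂ)) / 2 - 1 := by push_cast; ring
  rw [Fc, Fc, h, Complex.cpow_sub _ _ hn, Complex.cpow_one, zpow_add₀ hz, ← Complex.mul_conj]
  rw [← Complex.mul_conj] at hn
  field_simp

theorem Fc_sub_two (ζ : ℂ) (μ : ℤ) {z : ℂ} (hz : z ≠ 0) :
    Fc ζ (μ - 2) z = Fc ζ μ z * (conj z / z) := by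
  have hc : conj z ≠ 0 := by simpa using hz
  have h := Fc_add_two ζ (μ - 2) hz
  rw [sub_add_cancel] at h
  rw [h]
  field_simp

theorem norm_Fc (ζ : ℂ) (μ : ℤ) {z : ℂ} (hz : z ≠ 0) : ‖Fc ζ μ z‖ = ‖Fc ζ 0 z‖ := by
  have hp : 0 < Complex.normSq z := Complex.normSq_pos.2 hz
  have hz' : 0 < ‖z‖ := norm_pos_iff.2 hz
  simp only [Fc, norm_mul, norm_zpow, Complex.norm_cpow_eq_rpow_re_of_pos hp]
  rw [Complex.normSq_eq_norm_sq, ← Real.rpow_natCast, ← Real.rpow_mul hz'.le,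
    ← Real.rpow_mul hz'.le, ← Real.rpow_intCast, ← Real.rpow_intCast, ← Real.rpow_add hz',
    ← Real.rpow_add hz']
  congr 1
  simp
  ring

theorem continuousAt_Fc (ζ : ℂ) (μ : ℤ) {z : ℂ} (hz : z ≠ 0) : ContinuousAt (Fc ζ μ) z := by
  have hp : 0 < Complex.normSq z := Complex.normSq_pos.2 hz
  refine ContinuousAt.mul (ContinuousAt.cpow ?_ continuousAt_const ?_) ?_
  · exact (Complex.continuous_ofReal.comp Complex.continuous_normSq).continuousAt
  · exact Or.inl (by simpa using hp)
  · exact continuousAt_zpow₀ z μ (Or.inl hz)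

/-- The action of `𝔰𝔩₂` on the vectors `F_{ζ,μ}`. -/
theorem hasDerivAt_Fc (ζ : ℂ) (μ : ℤ) {α β : ℂ} (hα : conj α = -α) {z : ℝ → ℂ} {t : ℝ}
    (hz : HasDerivAt z (α * z t + β * conj (z t)) t) (h0 : z t ≠ 0) :
    HasDerivAt (fun s => Fc ζ μ (z s))
      (μ * α * Fc ζ μ (z t) + (ζ - (1 - (μ : ℂ)) / 2) * β * Fc ζ (μ - 2) (z t) +
        (ζ - (1 + (μ : ℂ)) / 2) * conj β * Fc ζ (μ + 2) (z t)) t := by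
  have hc : conj (z t) ≠ 0 := by simpa using h0
  have hn : (Complex.normSq (z t) : ℂ) ≠ 0 := by simpa using h0
  have hconj : HasDerivAt (fun s => conj (z s)) (conj (α * z t + β * conj (z t))) t := by
    simpa using hz.star
  have hN : HasDerivAt (fun s => (Complex.normSq (z s) : ℂ))
      ((α * z t + β * conj (z t)) * conj (z t) + z t * conj (α * z t + β * conj (z t))) t := by
    have h : (fun s => (Complex.normSq (z s) : ℂ)) = z * fun s => conj (z s) :=
      funext fun s => (Complex.mul_conj _).symm
    rw [h]
    exact hz.mul hconj
  have hA := HasDerivAt.comp t ((hasDerivAt_id (Complex.normSq (z t) : ℂ)).cpow_const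
    (c := ζ - (1 + (μ : ℂ)) / 2) (Or.inl (by simpa using h0))) hN
  have hB := (hasDerivAt_zpow μ (z t) (Or.inl h0)).comp t hz
  refine (hA.mul hB).congr_deriv ?_
  rw [Fc_add_two ζ μ h0, Fc_sub_two ζ μ h0, Fc]
  simp only [Function.comp, id]
  rw [Complex.cpow_sub _ 1 hn, Complex.cpow_one, zpow_sub_one₀ h0, ← Complex.mul_conj]
  simp only [map_add, map_mul, hα, Complex.conj_conj]
  field_simp
  ring

theorem hasDerivAt_intervalIntegral_of_continuous {f f' : ℝ → ℝ → ℂ} {p q : ℝ}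
    (hf : ∀ t, Continuous (f t)) (hf' : Continuous (Function.uncurry f'))
    (h : ∀ t θ, HasDerivAt (fun s => f s θ) (f' t θ) t) (t : ℝ) :
    HasDerivAt (fun s => ∫ θ in p..q, f s θ) (∫ θ in p..q, f' t θ) t := by
  obtain ⟨B, hB⟩ := ((isCompact_closedBall t 1).prod
    (isCompact_uIcc (a := p) (b := q))).exists_bound_of_continuousOn hf'.continuousOn
  have hf't : Continuous (f' t) := hf'.comp (Continuous.prodMk_right t)
  refine (intervalIntegral.hasDerivAt_integral_of_dominated_loc_of_deriv_le (bound := fun _ => B)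
    (Metric.closedBall_mem_nhds t one_pos)
    (Filter.Eventually.of_forall fun s => (hf s).aestronglyMeasurable)
    ((hf t).intervalIntegrable _ _) hf't.aestronglyMeasurable
    (Filter.Eventually.of_forall fun θ hθ s hs =>
      hB (s, θ) ⟨hs, Set.uIoc_subset_uIcc hθ⟩)
    intervalIntegrable_const (Filter.Eventually.of_forall fun θ _ s _ => h s θ)).2

/-- The `ν`-th Fourier coefficient of `F_{ζ,μ}` along the curve `z`. -/
noncomputable def fourierFc (ζ : ℂ) (μ ν : ℤ) (z : ℝ → ℂ) : ℂ :=
  ∫ θ in (-(Real.pi / 2))..(Real.pi / 2),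
    Fc ζ μ (z θ) * Complex.exp (-((ν : ℂ) * (θ : ℂ)) * Complex.I)

/-- The unipotent one-parameter group `z ↦ z + t(αz + β conj z)`. -/
noncomputable def unip (α β : ℂ) (t : ℝ) (z : ℂ) : ℂ := z + t * (α * z + β * conj z)

theorem unip_ne_zero {α β : ℂ} (hα : conj α = -α) (hαβ : α * α + β * conj β = 0) (t : ℝ)
    {z : ℂ} (hz : z ≠ 0) : unip α β t z ≠ 0 := by
  intro h
  apply hz
  have h' : unip α β t z - t * (α * unip α β t z + β * conj (unip α β t z)) = z := by
    simp only [unip, map_add, map_mul, Complex.conj_ofReal, Complex.conj_conj, hα]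
    linear_combination (-(t : ℂ) ^ 2 * z) * hαβ
  rw [← h', h]
  simp

theorem hasDerivAt_unip {α β : ℂ} (hα : conj α = -α) (hαβ : α * α + β * conj β = 0) (t : ℝ)
    (z : ℂ) : HasDerivAt (fun s => unip α β s z)
      (α * unip α β t z + β * conj (unip α β t z)) t := by
  have h := ((Complex.ofRealCLM.hasDerivAt (x := t)).mul_const (α * z + β * conj z)).const_add z
  refine h.congr_deriv ?_
  simp only [unip, map_add, map_mul, Complex.conj_ofReal, Complex.conj_conj, hα,
    Complex.ofRealCLM_apply, Complex.ofReal_one]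
  linear_combination (-(t : ℂ) * z) * hαβ

theorem continuous_Fc_unip (ζ : ℂ) (μ : ℤ) {α β : ℂ} (hα : conj α = -α)
    (hαβ : α * α + β * conj β = 0) {z : ℝ → ℂ} (hz : Continuous z) (h0 : ∀ θ, z θ ≠ 0) :
    Continuous fun p : ℝ × ℝ => Fc ζ μ (unip α β p.1 (z p.2)) := by
  rw [continuous_iff_continuousAt]
  intro p
  refine ContinuousAt.comp' (continuousAt_Fc ζ μ (unip_ne_zero hα hαβ _ (h0 _))) ?_
  refine Continuous.continuousAt ?_
  unfold unip
  have := Complex.continuous_conj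
  fun_prop

theorem hasDerivAt_fourierFc (ζ : ℂ) (μ ν : ℤ) {α β : ℂ} (hα : conj α = -α)
    (hαβ : α * α + β * conj β = 0) {z : ℝ → ℂ} (hz : Continuous z) (h0 : ∀ θ, z θ ≠ 0) (t : ℝ) :
    HasDerivAt (fun s => fourierFc ζ μ ν fun θ => unip α β s (z θ))
      (μ * α * fourierFc ζ μ ν (fun θ => unip α β t (z θ)) +
        (ζ - (1 - (μ : ℂ)) / 2) * β * fourierFc ζ (μ - 2) ν (fun θ => unip α β t (z θ)) +
        (ζ - (1 + (μ : ℂ)) / 2) * conj β * fourierFc ζ (μ + 2) ν (fun θ => unip α β t (z θ)))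
      t := by
  have hc : ∀ μ : ℤ, Continuous fun p : ℝ × ℝ => Fc ζ μ (unip α β p.1 (z p.2)) :=
    fun μ => continuous_Fc_unip ζ μ hα hαβ hz h0
  have hi : ∀ (μ : ℤ) (t : ℝ), Continuous fun θ : ℝ =>
      Fc ζ μ (unip α β t (z θ)) * Complex.exp (-((ν : ℂ) * (θ : ℂ)) * Complex.I) := fun μ t => by
    have := (hc μ).comp (Continuous.prodMk_right t)
    simp only [Function.comp_def] at this
    fun_prop
  have hint : ∀ (μ : ℤ) (c : ℂ), IntervalIntegrable (fun θ : ℝ => c *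
      (Fc ζ μ (unip α β t (z θ)) * Complex.exp (-((ν : ℂ) * (θ : ℂ)) * Complex.I)))
      volume (-(Real.pi / 2)) (Real.pi / 2) :=
    fun μ c => (continuous_const.mul (hi μ t)).intervalIntegrable _ _
  refine (hasDerivAt_intervalIntegral_of_continuous
    (f' := fun t θ => (μ * α * Fc ζ μ (unip α β t (z θ)) +
      (ζ - (1 - (μ : ℂ)) / 2) * β * Fc ζ (μ - 2) (unip α β t (z θ)) +
      (ζ - (1 + (μ : ℂ)) / 2) * conj β * Fc ζ (μ + 2) (unip α β t (z θ))) *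
        Complex.exp (-((ν : ℂ) * (θ : ℂ)) * Complex.I))
    (hi μ) ?_ ?_ t).congr_deriv ?_
  · have h1 := hc μ
    have h2 := hc (μ - 2)
    have h3 := hc (μ + 2)
    simp only [Function.uncurry_def]
    fun_prop
  · intro t θ
    exact (hasDerivAt_Fc ζ μ hα (hasDerivAt_unip hα hαβ t (z θ))
      (unip_ne_zero hα hαβ t (h0 θ))).mul_const _
  · simp only [fourierFc]
    rw [← intervalIntegral.integral_const_mul, ← intervalIntegral.integral_const_mul,
      ← intervalIntegral.integral_const_mul, ← intervalIntegral.integral_add (hint _ _) (hint _ _),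
      ← intervalIntegral.integral_add ((hint _ _).add (hint _ _)) (hint _ _)]
    refine intervalIntegral.integral_congr fun θ _ => ?_
    ring

theorem exists_norm_fourierFc_le (ζ : ℂ) (ν : ℤ) {α β : ℂ} (hα : conj α = -α)
    (hαβ : α * α + β * conj β = 0) {z : ℝ → ℂ} (hz : Continuous z) (h0 : ∀ θ, z θ ≠ 0) :
    ∃ M, ∀ μ : ℤ, ∀ t ∈ Set.Icc (0 : ℝ) 1,
      ‖fourierFc ζ μ ν fun θ => unip α β t (z θ)‖ ≤ M := by
  obtain ⟨B, hB⟩ := ((isCompact_Icc (a := (0 : ℝ)) (b := 1)).prod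
    (isCompact_uIcc (a := -(Real.pi / 2)) (b := Real.pi / 2))).exists_bound_of_continuousOn
    (continuous_Fc_unip ζ 0 hα hαβ hz h0).continuousOn
  refine ⟨B * |Real.pi / 2 - -(Real.pi / 2)|, fun μ t ht =>
    intervalIntegral.norm_integral_le_of_norm_le_const fun θ hθ => ?_⟩
  have he : ‖Complex.exp (-((ν : ℂ) * (θ : ℂ)) * Complex.I)‖ = 1 := by
    have := Complex.norm_exp_ofReal_mul_I (-(ν * θ))
    push_cast at this
    exact this
  rw [norm_mul, he, mul_one, norm_Fc ζ μ (unip_ne_zero hα hαβ t (h0 θ))]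
  exact hB (t, θ) ⟨ht, Set.uIoc_subset_uIcc hθ⟩

/-- The functional equation is preserved by small unipotent elements. -/
theorem fourierFc_unip {ζ : ℂ} {e ν : ℤ} (he : e = 0 ∨ e = 1) {d : ℤ → ℂ} {D : ℝ}
    (hD : ∀ k, ‖d k‖ ≤ D)
    (hd : ∀ k : ℤ, d (k + 1) * (ζ - (1 + (2 * k + e)) / 2) = d k * (-ζ - (1 + (2 * k + e)) / 2))
    (δ : ℂ) {α β : ℂ} (hα : conj α = -α) (hαβ : α * α + β * conj β = 0)
    (hα' : (‖ζ‖ + 2) * ‖α‖ ≤ 1 / 6) (hβ' : (‖ζ‖ + 2) * ‖β‖ ≤ 1 / 6)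
    {z : ℝ → ℂ} (hz : Continuous z) (h0 : ∀ θ, z θ ≠ 0)
    (h : ∀ k : ℤ, δ * fourierFc ζ (2 * k + e) ν z = d k * fourierFc (-ζ) (2 * k + e) ν z)
    (k : ℤ) :
    δ * fourierFc ζ (2 * k + e) ν (fun θ => unip α β 1 (z θ)) =
      d k * fourierFc (-ζ) (2 * k + e) ν (fun θ => unip α β 1 (z θ)) := by
  obtain ⟨M₁, hM₁⟩ := exists_norm_fourierFc_le ζ ν hα hαβ hz h0
  obtain ⟨M₂, hM₂⟩ := exists_norm_fourierFc_le (-ζ) ν hα hαβ hz h0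
  set I : ℂ → ℤ → ℝ → ℂ := fun ζ μ t => fourierFc ζ μ ν fun θ => unip α β t (z θ) with hI
  have hcoef : ∀ (w γ : ℂ) (n : ℕ), (‖ζ‖ + 2) * ‖γ‖ ≤ 1 / 6 → ‖w‖ ≤ (‖ζ‖ + 2) * (n + 1) →
      ‖w * γ‖ ≤ (n + 1) / 6 := fun w γ n hγ hw => by
    rw [norm_mul]
    calc ‖w‖ * ‖γ‖ ≤ (‖ζ‖ + 2) * (n + 1) * ‖γ‖ := by gcongr
      _ = (n + 1) * ((‖ζ‖ + 2) * ‖γ‖) := by ring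
      _ ≤ (n + 1) * (1 / 6) := by gcongr
      _ = (n + 1) / 6 := by ring
  have hk : ∀ k : ℤ, ‖(k : ℂ)‖ = k.natAbs := fun k => by
    rw [Complex.norm_intCast, Nat.cast_natAbs, Int.cast_abs]
  have hζ0 := norm_nonneg ζ
  refine sub_eq_zero.1 (tridiagonal_eq_zero (M := ‖δ‖ * M₁ + D * M₂)
    (u := fun k t => δ * I ζ (2 * k + e) t - d k * I (-ζ) (2 * k + e) t)
    (a := fun k _ => (2 * k + e) * α)
    (b := fun k _ => (ζ - (1 - (2 * k + e)) / 2) * β)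
    (c := fun k _ => (ζ - (1 + (2 * k + e)) / 2) * conj β) ?_ ?_ ?_ ?_ ?_ ?_ k)
  · intro k t
    have h1 := (hasDerivAt_fourierFc ζ (2 * k + e) ν hα hαβ hz h0 t).const_mul δ
    have h2 := (hasDerivAt_fourierFc (-ζ) (2 * k + e) ν hα hαβ hz h0 t).const_mul (d k)
    refine (h1.sub h2).congr_deriv ?_
    have e1 : 2 * (k - 1) + e = 2 * k + e - 2 := by ring
    have e2 : 2 * (k + 1) + e = 2 * k + e + 2 := by ring
    have d1 := hd k
    have d2 := hd (k - 1)
    rw [sub_add_cancel] at d2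
    simp only [hI, e1, e2]
    push_cast at d2 ⊢
    set A := fourierFc (-ζ) (2 * k + e - 2) ν (fun θ => unip α β t (z θ))
    set C := fourierFc (-ζ) (2 * k + e + 2) ν (fun θ => unip α β t (z θ))
    linear_combination (conj β * C) * d1 + (β * A) * d2
  · intro k _
    refine hcoef _ _ _ hα' ?_
    have : ‖(2 * k + e : ℂ)‖ ≤ 2 * k.natAbs + 1 := by
      refine (norm_add_le _ _).trans ?_
      rw [norm_mul, hk]
      rcases he with rfl | rfl <;> simp
    nlinarith [(Nat.cast_nonneg k.natAbs : (0 : ℝ) ≤ k.natAbs)]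
  · intro k _
    refine hcoef _ _ _ hβ' ?_
    have : ‖(ζ - (1 - (2 * k + e)) / 2 : ℂ)‖ ≤ ‖ζ‖ + k.natAbs + 1 := by
      rw [show (ζ - (1 - (2 * k + e)) / 2 : ℂ) = ζ + k + (e - 1) / 2 by ring]
      refine (norm_add₃_le).trans ?_
      rw [hk]
      gcongr
      rcases he with rfl | rfl <;> norm_num
    nlinarith [(Nat.cast_nonneg k.natAbs : (0 : ℝ) ≤ k.natAbs)]
  · intro k _
    refine hcoef _ _ _ (by simpa using hβ') ?_
    have : ‖(ζ - (1 + (2 * k + e)) / 2 : ℂ)‖ ≤ ‖ζ‖ + k.natAbs + 1 := by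
      rw [show (ζ - (1 + (2 * k + e)) / 2 : ℂ) = ζ + -k + -((e + 1) / 2) by ring]
      refine (norm_add₃_le).trans ?_
      rw [norm_neg, norm_neg, hk]
      gcongr
      rcases he with rfl | rfl <;> norm_num
    nlinarith [(Nat.cast_nonneg k.natAbs : (0 : ℝ) ≤ k.natAbs)]
  · intro k t ht
    refine (norm_sub_le _ _).trans ?_
    rw [norm_mul, norm_mul]
    exact add_le_add (mul_le_mul_of_nonneg_left (hM₁ _ t ht) (norm_nonneg _))
      (mul_le_mul (hD k) (hM₂ _ t ht) (norm_nonneg _) ((norm_nonneg _).trans (hD k)))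
  · intro k
    simpa [hI, unip, sub_eq_zero] using h k

/-- The complex coordinate on `ℝ²`. -/
noncomputable def planeToC (v : ℝ × ℝ) : ℂ := v.1 + v.2 * Complex.I

theorem Fz_eq (ζ : ℂ) (μ : ℤ) (v : ℝ × ℝ) :
    Fz ζ μ v = (Real.pi : ℂ) ^ (-(1/2) : ℂ) * Fc ζ μ (planeToC v) := by
  rw [Fz, Fc, planeToC, Complex.normSq_add_mul_I, mul_assoc]

/-- The image of the unit circle under `x`, as a curve in `ℂ`. -/
noncomputable def circleImage (x : Matrix.SpecialLinearGroup (Fin 2) ℝ) (θ : ℝ) : ℂ :=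
  planeToC (rowAct x (Real.cos θ, Real.sin θ))

theorem phi_eq (ζ : ℂ) (μ ν : ℤ) (x : Matrix.SpecialLinearGroup (Fin 2) ℝ) :
    phi ζ μ ν x = ((Real.pi : ℂ) ^ (-(1/2) : ℂ)) ^ 2 * fourierFc ζ μ ν (circleImage x) := by
  simp only [phi, fourierFc, Fz_eq, circleImage, mul_assoc, intervalIntegral.integral_const_mul,
    pow_two]

theorem continuous_circleImage (x : Matrix.SpecialLinearGroup (Fin 2) ℝ) :
    Continuous (circleImage x) := by
  unfold circleImage planeToC rowAct
  fun_prop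

theorem planeToC_rowAct_ne_zero (x : Matrix.SpecialLinearGroup (Fin 2) ℝ) {v : ℝ × ℝ}
    (hv : v ≠ 0) : planeToC (rowAct x v) ≠ 0 := by
  intro h
  apply hv
  have hdet := x.det_coe
  rw [Matrix.det_fin_two] at hdet
  have h1 := congrArg Complex.re h
  have h2 := congrArg Complex.im h
  simp [planeToC, rowAct] at h1 h2
  ext
  · simp only [Prod.fst_zero]
    linear_combination (-v.1) * hdet + x.1 1 1 * h1 - x.1 1 0 * h2
  · simp only [Prod.snd_zero]
    linear_combination (-v.2) * hdet - x.1 0 1 * h1 + x.1 0 0 * h2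

theorem circleImage_ne_zero (x : Matrix.SpecialLinearGroup (Fin 2) ℝ) (θ : ℝ) :
    circleImage x θ ≠ 0 := by
  refine planeToC_rowAct_ne_zero x fun h => ?_
  have h1 := congrArg Prod.fst h
  have h2 := congrArg Prod.snd h
  simp only [Prod.fst_zero, Prod.snd_zero] at h1 h2
  simpa [h1, h2] using Real.cos_sq_add_sin_sq θ

theorem sl2_mul_apply (x y : Matrix.SpecialLinearGroup (Fin 2) ℝ) (i j : Fin 2) :
    (x * y).1 i j = x.1 i 0 * y.1 0 j + x.1 i 1 * y.1 1 j := by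
  rw [← Fin.sum_univ_two fun l => x.1 i l * y.1 l j]
  rfl

/-- Upper unipotent elements of `SL(2,ℝ)`. -/
noncomputable def upperUnip (s : ℝ) : Matrix.SpecialLinearGroup (Fin 2) ℝ :=
  ⟨!![1, s; 0, 1], by simp [Matrix.det_fin_two]⟩

/-- Lower unipotent elements of `SL(2,ℝ)`. -/
noncomputable def lowerUnip (s : ℝ) : Matrix.SpecialLinearGroup (Fin 2) ℝ :=
  ⟨!![1, 0; s, 1], by simp [Matrix.det_fin_two]⟩

theorem upperUnip_val (s : ℝ) : (upperUnip s).1 = !![1, s; 0, 1] := rfl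

theorem lowerUnip_val (s : ℝ) : (lowerUnip s).1 = !![1, 0; s, 1] := rfl

theorem upperUnip_add (s t : ℝ) : upperUnip (s + t) = upperUnip s * upperUnip t := by
  ext i j
  fin_cases i <;> fin_cases j <;> simp [upperUnip_val, sl2_mul_apply, add_comm]

theorem lowerUnip_add (s t : ℝ) : lowerUnip (s + t) = lowerUnip s * lowerUnip t := by
  ext i j
  fin_cases i <;> fin_cases j <;> simp [lowerUnip_val, sl2_mul_apply]

theorem circleImage_mul_upperUnip (x : Matrix.SpecialLinearGroup (Fin 2) ℝ) (s : ℝ) :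
    circleImage (x * upperUnip s) =
      fun θ => unip (s / 2 * Complex.I) (s / 2 * Complex.I) 1 (circleImage x θ) := by
  funext θ
  apply Complex.ext <;>
    simp [circleImage, planeToC, rowAct, unip, upperUnip_val, sl2_mul_apply] <;>
    ring

theorem circleImage_mul_lowerUnip (x : Matrix.SpecialLinearGroup (Fin 2) ℝ) (s : ℝ) :
    circleImage (x * lowerUnip s) =
      fun θ => unip (-(s / 2 * Complex.I)) (s / 2 * Complex.I) 1 (circleImage x θ) := by
  funext θ
  apply Complex.ext <;>
    simp [circleImage, planeToC, rowAct, unip, lowerUnip_val, sl2_mul_apply]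
  ring

/-- A set containing `1` and stable under right multiplication by small unipotents is everything. -/
theorem sl2_induction {P : Matrix.SpecialLinearGroup (Fin 2) ℝ → Prop} {r : ℝ} (hr : 0 < r)
    (h1 : P 1) (hU : ∀ x s, |s| ≤ r → P x → P (x * upperUnip s))
    (hL : ∀ x s, |s| ≤ r → P x → P (x * lowerUnip s))
    (x : Matrix.SpecialLinearGroup (Fin 2) ℝ) : P x := by
  have ext_param : ∀ g : ℝ → Matrix.SpecialLinearGroup (Fin 2) ℝ,
      (∀ s t, g (s + t) = g s * g t) → (∀ x s, |s| ≤ r → P x → P (x * g s)) →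
      ∀ x s, P x → P (x * g s) := by
    intro g hg hstep x s hx
    have hn : ∀ (n : ℕ) (s : ℝ), |s| ≤ r → P (x * g (n * s)) := by
      intro n s hs
      induction n with
      | zero =>
        have : g 0 = 1 := by simpa using hg 0 0
        simpa [this] using hx
      | succ n ih =>
        have : ((n + 1 : ℕ) : ℝ) * s = n * s + s := by push_cast; ring
        rw [this, hg, ← mul_assoc]
        exact hstep _ s hs ih
    obtain ⟨n, hn'⟩ := exists_nat_gt (|s| / r)
    have hn0 : (0 : ℝ) < n := (by positivity : 0 ≤ |s| / r).trans_lt hn'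
    have := hn n (s / n) (by
      rw [abs_div, abs_of_pos hn0, div_le_iff₀ hn0, mul_comm]
      exact ((div_lt_iff₀ hr).1 hn').le)
    rwa [mul_div_cancel₀ _ hn0.ne'] at this
  have hU' := ext_param _ upperUnip_add hU
  have hL' := ext_param _ lowerUnip_add hL
  have main : ∀ y : Matrix.SpecialLinearGroup (Fin 2) ℝ, y.1 1 0 ≠ 0 → P y := by
    intro y hy
    have hdet := y.det_coe
    rw [Matrix.det_fin_two] at hdet
    have : y = 1 * upperUnip ((y.1 0 0 - 1) / y.1 1 0) * lowerUnip (y.1 1 0) *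
        upperUnip ((y.1 1 1 - 1) / y.1 1 0) := by
      ext i j
      fin_cases i <;> fin_cases j <;>
        simp [upperUnip_val, lowerUnip_val, sl2_mul_apply] <;> field_simp
      · ring
      · linear_combination -hdet
      · ring
    rw [this]
    exact hU' _ _ (hL' _ _ (hU' _ _ h1))
  by_cases hx : x.1 1 0 = 0
  · have hdet := x.det_coe
    rw [Matrix.det_fin_two, hx, mul_zero, sub_zero] at hdet
    have h11 : x.1 1 1 ≠ 0 := right_ne_zero_of_mul_eq_one hdet
    have := hL' (x * lowerUnip 1) (-1)
      (main _ (by simpa [lowerUnip_val, sl2_mul_apply, hx] using h11))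
    rw [mul_assoc, ← lowerUnip_add] at this
    have h0 : lowerUnip (1 + -1) = 1 := by
      ext i j
      fin_cases i <;> fin_cases j <;> simp [lowerUnip_val]
    rwa [h0, mul_one] at this
  · exact main x hx

theorem Fc_circleImage_one (ζ : ℂ) (μ : ℤ) (θ : ℝ) :
    Fc ζ μ (circleImage 1 θ) = Complex.exp (μ * (θ * Complex.I)) := by
  have h : circleImage 1 θ = Complex.exp (θ * Complex.I) := by
    simp [circleImage, planeToC, rowAct, Complex.exp_mul_I]
  rw [Fc, h, Complex.normSq_eq_norm_sq, Complex.norm_exp_ofReal_mul_I, Complex.exp_int_mul]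
  simp

theorem fourierFc_circleImage_one (ζ : ℂ) (e k m : ℤ) (hkm : k ≠ m) :
    fourierFc ζ (2 * k + e) (2 * m + e) (circleImage 1) = 0 := by
  have hc : (2 * (k - m) * Complex.I : ℂ) ≠ 0 := by
    have : (k - m : ℂ) ≠ 0 := by exact_mod_cast sub_ne_zero.2 hkm
    simp [this]
  have h := integral_exp_mul_complex (a := -(Real.pi / 2)) (b := Real.pi / 2) hc
  rw [fourierFc]
  simp only [Fc_circleImage_one, ← Complex.exp_add]
  convert! h using 1
  · refine intervalIntegral.integral_congr fun θ _ => ?_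
    congr 1
    push_cast
    ring
  · symm
    rw [div_eq_zero_iff, sub_eq_zero, Complex.exp_eq_exp_iff_exists_int]
    refine Or.inl ⟨k - m, ?_⟩
    push_cast
    ring

/-- The functional equation for abstract coefficients `d` satisfying the intertwining relation. -/
theorem fourierFc_functional_equation {ζ : ℂ} {e : ℤ} (he : e = 0 ∨ e = 1) {d : ℤ → ℂ} {D : ℝ}
    (hD : ∀ k, ‖d k‖ ≤ D)
    (hd : ∀ k : ℤ, d (k + 1) * (ζ - (1 + (2 * k + e)) / 2) = d k * (-ζ - (1 + (2 * k + e)) / 2))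
    (k m : ℤ) (x : Matrix.SpecialLinearGroup (Fin 2) ℝ) :
    d m * fourierFc ζ (2 * k + e) (2 * m + e) (circleImage x) =
      d k * fourierFc (-ζ) (2 * k + e) (2 * m + e) (circleImage x) := by
  have hsmall : ∀ s : ℝ, |s| ≤ 1 / (3 * (‖ζ‖ + 2)) →
      (‖ζ‖ + 2) * ‖(s / 2 * Complex.I : ℂ)‖ ≤ 1 / 6 := fun s hs => by
    rw [le_div_iff₀ (by positivity)] at hs
    simp only [norm_mul, norm_div, Complex.norm_real, Complex.norm_I, Real.norm_eq_abs,
      Complex.norm_ofNat, mul_one]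
    linarith
  have hI : ∀ s : ℝ, conj (s / 2 * Complex.I : ℂ) = -(s / 2 * Complex.I) := fun s => by
    rw [map_mul, map_div₀, Complex.conj_ofReal, Complex.conj_I, map_ofNat, mul_neg]
  refine sl2_induction (P := fun x => ∀ k : ℤ,
    d m * fourierFc ζ (2 * k + e) (2 * m + e) (circleImage x) =
      d k * fourierFc (-ζ) (2 * k + e) (2 * m + e) (circleImage x))
    (r := 1 / (3 * (‖ζ‖ + 2))) (by positivity) ?_ ?_ ?_ x k
  · intro k
    by_cases hkm : k = m
    · subst hkm
      simp only [fourierFc, Fc_circleImage_one]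
    · simp [fourierFc_circleImage_one _ _ _ _ hkm]
  · intro x s hs hx k
    rw [circleImage_mul_upperUnip]
    exact fourierFc_unip he hD hd _ (hI s) (by rw [hI]; ring) (hsmall s hs) (hsmall s hs)
      (continuous_circleImage x) (circleImage_ne_zero x) hx k
  · intro x s hs hx k
    rw [circleImage_mul_lowerUnip]
    exact fourierFc_unip he hD hd _ (by rw [map_neg, hI]) (by rw [hI]; ring)
      (by rw [norm_neg]; exact hsmall s hs) (hsmall s hs)
      (continuous_circleImage x) (circleImage_ne_zero x) hx k

/-- The quotient `Γ(1/2+ζ+μ/2)/Γ(1/2-ζ+μ/2)` at `μ = 2k + e`. -/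
noncomputable def gammaRatio (ζ : ℂ) (e k : ℤ) : ℂ :=
  Complex.Gamma (1/2 + ζ + ((2 * k + e : ℤ) : ℂ)/2) /
    Complex.Gamma (1/2 - ζ + ((2 * k + e : ℤ) : ℂ)/2)

theorem gammaRatio_neg (ζ : ℂ) (e k : ℤ) : gammaRatio (-ζ) e k = (gammaRatio ζ e k)⁻¹ := by
  rw [gammaRatio, gammaRatio, inv_div, sub_neg_eq_add, ← sub_eq_add_neg]

theorem gamma_argument_ne_int {ζ : ℂ} (hζ : |ζ.re| < 1/2) {e : ℤ} (he : e = 0 ∨ e = 1)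
    (h0 : ¬(ζ = 0 ∧ e = 1)) (k n : ℤ) : 1/2 + ζ + ((2 * k + e : ℤ) : ℂ)/2 ≠ n := by
  intro h
  rw [abs_lt] at hζ
  rcases he with rfl | rfl
  · have hre : ζ.re = n - k - 1/2 := by
      have : ζ = ((n - k - 1/2 : ℝ) : ℂ) := by push_cast at h ⊢; linear_combination h
      rw [this, Complex.ofReal_re]
    rw [hre] at hζ
    have h1 : (0 : ℝ) < (n - k : ℤ) := by push_cast; linarith [hζ.1]
    have h2 : ((n - k : ℤ) : ℝ) < (1 : ℤ) := by push_cast; linarith [hζ.2]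
    have h1 : (0 : ℤ) < n - k := by exact_mod_cast h1
    have h2 : n - k < 1 := by exact_mod_cast h2
    omega
  · have hz : ζ = ((n - k - 1 : ℤ) : ℂ) := by push_cast at h ⊢; linear_combination h
    have hre : ζ.re = (n - k - 1 : ℤ) := by rw [hz, Complex.intCast_re]
    rw [hre] at hζ
    have h1 : ((-1 : ℤ) : ℝ) < (n - k - 1 : ℤ) := by push_cast at hζ ⊢; linarith [hζ.1]
    have h2 : ((n - k - 1 : ℤ) : ℝ) < (1 : ℤ) := by push_cast at hζ ⊢; linarith [hζ.2]
    have h1 : (-1 : ℤ) < n - k - 1 := by exact_mod_cast h1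
    have h2 : n - k - 1 < 1 := by exact_mod_cast h2
    have : n - k - 1 = 0 := by omega
    exact h0 ⟨by rw [hz, this, Int.cast_zero], rfl⟩

theorem gammaRatio_ne_zero {ζ : ℂ} (hζ : |ζ.re| < 1/2) {e : ℤ} (he : e = 0 ∨ e = 1)
    (h0 : ¬(ζ = 0 ∧ e = 1)) (k : ℤ) : gammaRatio ζ e k ≠ 0 := by
  refine div_ne_zero (Complex.Gamma_ne_zero fun n h => ?_) (Complex.Gamma_ne_zero fun n h => ?_)
  · exact gamma_argument_ne_int hζ he h0 k (-n) (by exact_mod_cast h)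
  · exact gamma_argument_ne_int (ζ := -ζ) (by simpa using hζ) he (by simpa using h0) k (-n)
      (by rw [← sub_eq_add_neg]; exact_mod_cast h)

theorem gammaRatio_add_one {ζ : ℂ} (hζ : |ζ.re| < 1/2) {e : ℤ} (he : e = 0 ∨ e = 1)
    (h0 : ¬(ζ = 0 ∧ e = 1)) (k : ℤ) :
    gammaRatio ζ e (k + 1) * (ζ - (1 + (2 * k + e)) / 2) =
      gammaRatio ζ e k * (-ζ - (1 + (2 * k + e)) / 2) := by
  have ha := gamma_argument_ne_int hζ he h0 k 0
  have hb := gamma_argument_ne_int (ζ := -ζ) (by simpa using hζ) he (by simpa using h0) k 0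
  rw [Int.cast_zero] at ha hb
  rw [← sub_eq_add_neg] at hb
  have e1 : 1/2 + ζ + ((2 * (k + 1) + e : ℤ) : ℂ)/2 = 1/2 + ζ + ((2 * k + e : ℤ) : ℂ)/2 + 1 := by
    push_cast; ring
  have e2 : 1/2 - ζ + ((2 * (k + 1) + e : ℤ) : ℂ)/2 = 1/2 - ζ + ((2 * k + e : ℤ) : ℂ)/2 + 1 := by
    push_cast; ring
  have e3 : ζ - (1 + (2 * k + e)) / 2 = -(1/2 - ζ + ((2 * k + e : ℤ) : ℂ)/2) := by
    push_cast; ring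
  have e4 : -ζ - (1 + (2 * k + e)) / 2 = -(1/2 + ζ + ((2 * k + e : ℤ) : ℂ)/2) := by
    push_cast; ring
  rw [gammaRatio, gammaRatio, e1, e2, e3, e4, Complex.Gamma_add_one _ ha,
    Complex.Gamma_add_one _ hb, mul_div_mul_comm]
  rw [mul_neg, mul_neg, mul_right_comm, div_mul_cancel₀ _ hb, mul_comm]

theorem norm_gammaRatio_le {ζ : ℂ} (hζ : |ζ.re| < 1/2) {e : ℤ} (he : e = 0 ∨ e = 1)
    (h0 : ¬(ζ = 0 ∧ e = 1)) (hre : ζ.re ≤ 0) (k : ℤ) :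
    ‖gammaRatio ζ e k‖ ≤ ‖gammaRatio ζ e 0‖ := by
  have hrec : ∀ k : ℤ, ‖gammaRatio ζ e (k + 1)‖ * ‖(1 + (2 * k + e : ℝ)) / 2 - ζ‖ =
      ‖gammaRatio ζ e k‖ * ‖(1 + (2 * k + e : ℝ)) / 2 + ζ‖ := fun k => by
    have := congrArg norm (gammaRatio_add_one hζ he h0 k)
    rw [norm_mul, norm_mul, norm_sub_rev, ← norm_neg (-ζ - _)] at this
    convert! this using 3
    · push_cast; ring
    · push_cast; ring
  have hpos : ∀ k : ℤ, 0 < ‖(1 + (2 * k + e : ℝ)) / 2 - ζ‖ ∧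
      0 < ‖(1 + (2 * k + e : ℝ)) / 2 + ζ‖ := fun k => by
    refine ⟨norm_pos_iff.2 fun h => ?_, norm_pos_iff.2 fun h => ?_⟩
    · refine gamma_argument_ne_int (ζ := -ζ) (by simpa using hζ) he (by simpa using h0) k 0 ?_
      push_cast at h ⊢
      linear_combination h
    · refine gamma_argument_ne_int hζ he h0 k 0 ?_
      push_cast at h ⊢
      linear_combination h
  have hcmp : ∀ r : ℝ, 0 ≤ r → ‖(r : ℂ) + ζ‖ ≤ ‖(r : ℂ) - ζ‖ := fun r hr => by
    rw [← sq_le_sq₀ (norm_nonneg _) (norm_nonneg _), ← Complex.normSq_eq_norm_sq,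
      ← Complex.normSq_eq_norm_sq, Complex.normSq_apply, Complex.normSq_apply]
    simp
    nlinarith
  have he' : (0 : ℝ) ≤ e ∧ (e : ℝ) ≤ 1 := by rcases he with rfl | rfl <;> simp
  induction k using Int.induction_on with
  | zero => exact le_rfl
  | succ n ih =>
    refine le_trans (le_of_mul_le_mul_right ?_ (hpos n).1) ih
    rw [hrec]
    refine mul_le_mul_of_nonneg_left ?_ (norm_nonneg _)
    have := hcmp ((1 + (2 * n + e : ℝ)) / 2) (by linarith [he'.1, (Nat.cast_nonneg n : (0:ℝ) ≤ n)])
    simpa using this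
  | pred n ih =>
    refine le_trans (le_of_mul_le_mul_right ?_ (hpos (-n - 1)).2) ih
    rw [← hrec, sub_add_cancel]
    refine mul_le_mul_of_nonneg_left ?_ (norm_nonneg _)
    have := hcmp (-((1 + (2 * (-n - 1) + e : ℝ)) / 2))
      (by linarith [he'.2, (Nat.cast_nonneg n : (0:ℝ) ≤ n)])
    rw [← norm_neg (_ - ζ), ← norm_neg (_ + ζ)] at this
    convert! this using 2
    · push_cast; ring
    · push_cast; ring

theorem phi_functional_equation {ζ : ℂ} (hζ : |ζ.re| < 1/2) {e : ℤ} (he : e = 0 ∨ e = 1)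
    (h0 : ¬(ζ = 0 ∧ e = 1)) (k m : ℤ) (x : Matrix.SpecialLinearGroup (Fin 2) ℝ) :
    gammaRatio ζ e m * phi ζ (2 * k + e) (2 * m + e) x =
      gammaRatio ζ e k * phi (-ζ) (2 * k + e) (2 * m + e) x := by
  rcases le_total ζ.re 0 with hre | hre
  · rw [phi_eq, phi_eq, mul_left_comm, mul_left_comm (gammaRatio ζ e k),
      fourierFc_functional_equation he (norm_gammaRatio_le hζ he h0 hre)
        (gammaRatio_add_one hζ he h0)]
  · have hζ' : |(-ζ).re| < 1/2 := by simpa using hζ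
    have h0' : ¬(-ζ = 0 ∧ e = 1) := by simpa using h0
    have h := fourierFc_functional_equation he
      (norm_gammaRatio_le hζ' he h0' (by simpa using hre)) (gammaRatio_add_one hζ' he h0') k m x
    have hk := gammaRatio_ne_zero hζ he h0 k
    have hm := gammaRatio_ne_zero hζ he h0 m
    rw [gammaRatio_neg, gammaRatio_neg, neg_neg] at h
    field_simp at h
    rw [phi_eq, phi_eq]
    linear_combination -((Real.pi : ℂ) ^ (-(1/2) : ℂ)) ^ 2 * h

/-- for `ε ∈ {0,1}`, `μ ≡ ν ≡ ε (mod 2)`, `|Re ζ| < 1/2`, `(ζ,ε) ≠ (0,1)`,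
`φ^{μ,ν}_ζ = (d(ζ,μ)/d(ζ,ν)) φ^{μ,ν}_{-ζ}` where
`d(ζ,k) = 2^{2ζ} Γ(1/2+ζ+k/2)/Γ(1/2-ζ+k/2)`; in particular `φ^{μ,μ}_ζ = φ^{μ,μ}_{-ζ}`. -/
theorem stmt_19 (ε : ℕ) (hε : ε = 0 ∨ ε = 1) (μ ν : ℤ)
    (hμ : μ % 2 = (ε : ℤ)) (hν : ν % 2 = (ε : ℤ))
    (ζ : ℂ) (hζ : |ζ.re| < 1/2) (hζε : ¬(ζ = 0 ∧ ε = 1)) :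
    (∀ x : Matrix.SpecialLinearGroup (Fin 2) ℝ,
      phi ζ μ ν x
        = ((2 : ℂ) ^ (2 * ζ) * Complex.Gamma (1/2 + ζ + (μ : ℂ)/2) /
              Complex.Gamma (1/2 - ζ + (μ : ℂ)/2)) /
            ((2 : ℂ) ^ (2 * ζ) * Complex.Gamma (1/2 + ζ + (ν : ℂ)/2) /
              Complex.Gamma (1/2 - ζ + (ν : ℂ)/2)) *
            phi (-ζ) μ ν x) ∧
    (∀ x : Matrix.SpecialLinearGroup (Fin 2) ℝ, phi ζ μ μ x = phi (-ζ) μ μ x) := by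
  have he : (ε : ℤ) = 0 ∨ (ε : ℤ) = 1 := by exact_mod_cast hε
  have h0 : ¬(ζ = 0 ∧ (ε : ℤ) = 1) := by exact_mod_cast hζε
  obtain ⟨k, rfl⟩ : ∃ k : ℤ, μ = 2 * k + ε := ⟨μ / 2, by omega⟩
  obtain ⟨m, rfl⟩ : ∃ m : ℤ, ν = 2 * m + ε := ⟨ν / 2, by omega⟩
  have h2 : (2 : ℂ) ^ (2 * ζ) ≠ 0 := by simp [Complex.cpow_eq_zero_iff]
  refine ⟨fun x => ?_, fun x => ?_⟩
  · have hΓ : ∀ k : ℤ, (2 : ℂ) ^ (2 * ζ) * Complex.Gamma (1/2 + ζ + ((2 * k + ε : ℤ) : ℂ)/2) /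
        Complex.Gamma (1/2 - ζ + ((2 * k + ε : ℤ) : ℂ)/2) =
          (2 : ℂ) ^ (2 * ζ) * gammaRatio ζ ε k := fun k => mul_div_assoc _ _ _
    rw [hΓ, hΓ, mul_div_mul_left _ _ h2, div_mul_eq_mul_div,
      eq_div_iff (gammaRatio_ne_zero hζ he h0 m), mul_comm]
    exact phi_functional_equation hζ he h0 k m x
  · exact mul_left_cancel₀ (gammaRatio_ne_zero hζ he h0 k)
      (phi_functional_equation hζ he h0 k k x)
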